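/- Let X be a square-integrable real-valued random variable with continuous distribution function F(·;X). Then Var[X] = ∑_{j≥1} |LP(j;X)|², where LP(j;X) = E[X · Leg_j(F(X;X))]. -/

import Mathlib

open MeasureTheory Set

/-- The `j`-th orthonormal shifted Legendre polynomial on `[0,1]` (Rodrigues'
formula), the result of Gram–Schmidt orthonormalization of `1, u, u², …` in
`L²([0,1])`. In particular `Leg 0 = 1` and `Leg 1 u = √12 (u − 1/2)`. -/
noncomputable def Leg (j : ℕ) (u : ℝ) : ℝ :=
  (Real.sqrt (2 * j + 1) / j.factorial) * iteratedDeriv j (fun x => (x ^ 2 - x) ^ j) u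

/-- The distribution function `F(x;X) = P(X ≤ x)`. -/
noncomputable def distFun {Ω : Type*} [MeasurableSpace Ω] (P : Measure Ω)
    (X : Ω → ℝ) (x : ℝ) : ℝ :=
  (P (X ⁻¹' Iic x)).toReal

section Polynomials

open Polynomial

/-- Integration by parts on `[0, 1]` for polynomials, when the boundary terms vanish. -/
theorem integral_eval_mul_derivative (p q : ℝ[X]) (h0 : q.eval 0 = 0) (h1 : q.eval 1 = 0) :
    ∫ x in (0 : ℝ)..1, (p * derivative q).eval x
      = -∫ x in (0 : ℝ)..1, (derivative p * q).eval x := by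
  have h := intervalIntegral.integral_mul_deriv_eq_deriv_mul (a := 0) (b := 1)
    (fun x _ => p.hasDerivAt x) (fun x _ => q.hasDerivAt x)
    (p.derivative.continuous.intervalIntegrable 0 1)
    (q.derivative.continuous.intervalIntegrable 0 1)
  simpa [h0, h1] using h

/-- Iterated integration by parts on `[0, 1]` for polynomials vanishing to order `j` at the
endpoints. -/
theorem integral_eval_mul_iterate_derivative (j : ℕ) (p q : ℝ[X])
    (h : ∀ i < j, (derivative^[i] q).eval 0 = 0 ∧ (derivative^[i] q).eval 1 = 0) :
    ∫ x in (0 : ℝ)..1, (p * derivative^[j] q).eval x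
      = (-1) ^ j * ∫ x in (0 : ℝ)..1, (derivative^[j] p * q).eval x := by
  induction j generalizing p with
  | zero => simp
  | succ j ih =>
    rw [Function.iterate_succ_apply', integral_eval_mul_derivative _ _ (h j (by omega)).1
      (h j (by omega)).2, ih _ fun i hi => h i (by omega), ← Function.iterate_succ_apply]
    ring

theorem eval_iterate_derivative_sq_sub_self_pow {i j : ℕ} (hij : i < j) {r : ℝ}
    (hr : r ^ 2 - r = 0) :
    (derivative^[i] ((X ^ 2 - X : ℝ[X]) ^ j)).eval r = 0 := by
  obtain ⟨s, hs⟩ := pow_sub_dvd_iterate_derivative_pow (X ^ 2 - X : ℝ[X]) j i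
  rw [hs, eval_mul, eval_pow]
  simp [hr, Nat.sub_ne_zero_of_lt hij]

theorem integral_eval_sq_sub_self_pow (j : ℕ) :
    ∫ x in (0 : ℝ)..1, ((X ^ 2 - X : ℝ[X]) ^ j).eval x
      = (-1) ^ j * (j.factorial : ℝ) ^ 2 / (2 * j + 1).factorial := by
  induction j with
  | zero => simp
  | succ j ih =>
    have key := integral_eval_mul_derivative (2 * X - 1) ((X ^ 2 - X) ^ (j + 1))
      (by simp) (by simp)
    have e1 : (2 * X - 1 : ℝ[X]) * derivative ((X ^ 2 - X) ^ (j + 1))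
        = C (4 * (j + 1) : ℝ) * (X ^ 2 - X) ^ (j + 1) + C (j + 1 : ℝ) * (X ^ 2 - X) ^ j := by
      simp only [derivative_pow_succ, derivative_sub, derivative_X, C_mul, C_add,
        map_natCast, map_ofNat, map_one]
      ring
    have e2 : derivative (2 * X - 1 : ℝ[X]) * (X ^ 2 - X) ^ (j + 1)
        = C 2 * (X ^ 2 - X) ^ (j + 1) := by
      simp [C_ofNat]
    have hadd (a b : ℝ) (p q : ℝ[X]) : ∫ x in (0 : ℝ)..1, (a * p.eval x + b * q.eval x)
        = a * (∫ x in (0 : ℝ)..1, p.eval x) + b * ∫ x in (0 : ℝ)..1, q.eval x := by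
      rw [intervalIntegral.integral_add
        (Continuous.intervalIntegrable (by fun_prop) _ _)
        (Continuous.intervalIntegrable (by fun_prop) _ _),
        intervalIntegral.integral_const_mul, intervalIntegral.integral_const_mul]
    rw [e1, e2] at key
    simp only [eval_add, eval_mul (p := C _), eval_C] at key
    rw [hadd, intervalIntegral.integral_const_mul, ih] at key
    have hf : ((2 * (j + 1) + 1).factorial : ℝ)
        = (2 * j + 3) * (2 * j + 2) * (2 * j + 1).factorial := by
      rw [show 2 * (j + 1) + 1 = 2 * j + 1 + 1 + 1 by ring, Nat.factorial_succ, Nat.factorial_succ]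
      push_cast
      ring
    have hpos : ((2 * j + 1).factorial : ℝ) ≠ 0 := by positivity
    have h3 : (2 * j + 3 : ℝ) ≠ 0 := by positivity
    have h2 : (2 * j + 2 : ℝ) ≠ 0 := by positivity
    rw [hf, Nat.factorial_succ, eq_div_iff (by positivity)]
    push_cast
    field_simp at key
    rw [pow_succ (-1 : ℝ)]
    linear_combination (j + 1 : ℝ) * key

/-- The normalized shifted Legendre polynomials as polynomials. -/
noncomputable def legPoly (j : ℕ) : ℝ[X] :=
  C (Real.sqrt (2 * j + 1) / j.factorial) * derivative^[j] ((X ^ 2 - X) ^ j)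

theorem iteratedDeriv_eval (p : ℝ[X]) (j : ℕ) :
    iteratedDeriv j (fun x => p.eval x) = fun x => (derivative^[j] p).eval x := by
  induction j with
  | zero => simp
  | succ j ih =>
    rw [iteratedDeriv_succ, ih, Function.iterate_succ_apply']
    ext x
    simp

theorem legPoly_eval (j : ℕ) (u : ℝ) : (legPoly j).eval u = Leg j u := by
  have h := congrFun (iteratedDeriv_eval ((X ^ 2 - X) ^ j) j) u
  simp only [eval_pow, eval_sub, eval_X] at h
  rw [Leg, h, legPoly, eval_mul, eval_C]

theorem Leg_zero (u : ℝ) : Leg 0 u = 1 := by simp [Leg]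

theorem natDegree_sq_sub_self_pow (j : ℕ) : ((X ^ 2 - X : ℝ[X]) ^ j).natDegree = 2 * j := by
  have : (X ^ 2 - X : ℝ[X]).natDegree = 2 := by compute_degree!
  rw [natDegree_pow, this, mul_comm]

theorem coeff_sq_sub_self_pow (j : ℕ) : ((X ^ 2 - X : ℝ[X]) ^ j).coeff (2 * j) = 1 := by
  have h : (X ^ 2 - X : ℝ[X]).Monic := by monicity!
  have := (h.pow j).coeff_natDegree
  rwa [natDegree_sq_sub_self_pow] at this

theorem iterate_derivative_sq_sub_self_pow (j : ℕ) :
    derivative^[2 * j] ((X ^ 2 - X : ℝ[X]) ^ j) = C ((2 * j).factorial : ℝ) := by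
  ext n
  rw [coeff_iterate_derivative, coeff_C]
  rcases eq_or_ne n 0 with rfl | hn
  · simp [coeff_sq_sub_self_pow, Nat.descFactorial_self]
  · rw [coeff_eq_zero_of_natDegree_lt (by rw [natDegree_sq_sub_self_pow]; omega)]
    simp [hn]

theorem degree_legPoly (j : ℕ) : (legPoly j).degree = j := by
  have hc : Real.sqrt (2 * j + 1) / j.factorial ≠ 0 := by positivity
  rw [legPoly, degree_C_mul hc]
  refine degree_eq_of_le_of_coeff_ne_zero ?_ ?_
  · refine degree_le_of_natDegree_le ((natDegree_iterate_derivative _ _).trans ?_)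
    rw [natDegree_sq_sub_self_pow]
    omega
  · rw [coeff_iterate_derivative, ← two_mul, coeff_sq_sub_self_pow]
    have : (2 * j).descFactorial j ≠ 0 := by
      rw [Ne, Nat.descFactorial_eq_zero_iff_lt]
      omega
    simpa using this

theorem span_range_legPoly : Submodule.span ℝ (range legPoly) = ⊤ :=
  Polynomial.Sequence.span ⟨legPoly, degree_legPoly⟩
    fun i => (leadingCoeff_ne_zero.mpr (Sequence.ne_zero _ i)).isUnit

theorem integral_eval_mul_legPoly (p : ℝ[X]) (j : ℕ) :
    ∫ x in (0 : ℝ)..1, (p * legPoly j).eval x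
      = Real.sqrt (2 * j + 1) / j.factorial
        * ((-1) ^ j * ∫ x in (0 : ℝ)..1, (derivative^[j] p * (X ^ 2 - X) ^ j).eval x) := by
  rw [← integral_eval_mul_iterate_derivative j p _ fun i hi =>
    ⟨eval_iterate_derivative_sq_sub_self_pow hi (by simp),
      eval_iterate_derivative_sq_sub_self_pow hi (by simp)⟩, legPoly, mul_left_comm,
    ← intervalIntegral.integral_const_mul]
  simp only [eval_mul (p := C _), eval_C]

theorem integral_legPoly_mul_of_lt {i j : ℕ} (hij : i < j) :
    ∫ x in (0 : ℝ)..1, (legPoly i * legPoly j).eval x = 0 := by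
  rw [integral_eval_mul_legPoly, iterate_derivative_eq_zero_of_degree_lt]
  · simp
  · rw [degree_legPoly]
    exact_mod_cast hij

theorem integral_legPoly_mul_self (j : ℕ) :
    ∫ x in (0 : ℝ)..1, (legPoly j * legPoly j).eval x = 1 := by
  rw [integral_eval_mul_legPoly, legPoly, iterate_derivative_C_mul, ← Function.iterate_add_apply,
    ← two_mul, iterate_derivative_sq_sub_self_pow, ← C_mul]
  simp only [eval_mul (p := C _), eval_C]
  rw [intervalIntegral.integral_const_mul, integral_eval_sq_sub_self_pow, Nat.factorial_succ]
  have hs : Real.sqrt (2 * j + 1) * Real.sqrt (2 * j + 1) = 2 * j + 1 :=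
    Real.mul_self_sqrt (by positivity)
  have hm : ((-1 : ℝ) ^ j) * (-1) ^ j = 1 := by rw [← mul_pow]; simp
  have h1 : (2 * j + 1 : ℝ) ≠ 0 := by positivity
  push_cast
  field_simp
  linear_combination (Real.sqrt (2 * j + 1)) ^ 2 * hm + hs

theorem integral_legPoly_mul (i j : ℕ) :
    ∫ x in (0 : ℝ)..1, (legPoly i * legPoly j).eval x = if i = j then 1 else 0 := by
  rcases lt_trichotomy i j with h | rfl | h
  · rw [integral_legPoly_mul_of_lt h, if_neg h.ne]
  · rw [integral_legPoly_mul_self, if_pos rfl]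
  · rw [mul_comm, integral_legPoly_mul_of_lt h, if_neg h.ne']

end Polynomials

section Basis

open Polynomial

theorem memLp_polynomial_eval (p : ℝ[X]) :
    MemLp (fun x => p.eval x) 2 (volume.restrict (Ioo (0 : ℝ) 1)) := by
  obtain ⟨C, hC⟩ := (isCompact_Icc (a := (0 : ℝ)) (b := 1)).exists_bound_of_continuousOn
    p.continuous.continuousOn
  exact MemLp.of_bound p.continuous.aestronglyMeasurable C <|
    (ae_restrict_mem measurableSet_Ioo).mono fun x hx => hC x (Ioo_subset_Icc_self hx)

/-- Polynomials as elements of `L²(0, 1)`. -/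
noncomputable def polyToLp : ℝ[X] →ₗ[ℝ] Lp ℝ 2 (volume.restrict (Ioo (0 : ℝ) 1)) where
  toFun p := (memLp_polynomial_eval p).toLp
  map_add' p q := by
    rw [← MemLp.toLp_add]
    congr 1
    ext x
    simp
  map_smul' c p := by
    rw [RingHom.id_apply, ← MemLp.toLp_const_smul]
    congr 1
    ext x
    simp

theorem coeFn_polyToLp (p : ℝ[X]) :
    polyToLp p =ᵐ[volume.restrict (Ioo (0 : ℝ) 1)] fun x => p.eval x :=
  (memLp_polynomial_eval p).coeFn_toLp

theorem orthonormal_polyToLp_legPoly : Orthonormal ℝ fun j => polyToLp (legPoly j) := by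
  rw [orthonormal_iff_ite]
  intro i j
  rw [← integral_legPoly_mul, intervalIntegral.integral_of_le zero_le_one,
    integral_Ioc_eq_integral_Ioo, L2.inner_def]
  refine integral_congr_ae ?_
  filter_upwards [coeFn_polyToLp (legPoly i), coeFn_polyToLp (legPoly j)] with x hi hj
  simp [hi, hj, mul_comm]

/-- Polynomials are dense in `L²(0, 1)`. -/
theorem denseRange_polyToLp : DenseRange polyToLp := by
  intro f
  rw [Metric.mem_closure_iff]
  intro ε hε
  obtain ⟨g, hg, hgm⟩ := (Lp.memLp f).exists_boundedContinuous_eLpNorm_sub_le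
    (by simp) (ε := ENNReal.ofReal (ε / 3)) (by simpa using hε)
  obtain ⟨p, hp⟩ := exists_polynomial_near_of_continuousOn 0 1 g g.continuous.continuousOn
    (ε / 3) (by positivity)
  refine ⟨polyToLp p, mem_range_self p, ?_⟩
  have hgp : eLpNorm (⇑g - fun x => p.eval x) 2 (volume.restrict (Ioo (0 : ℝ) 1))
      ≤ ENNReal.ofReal (ε / 3) := by
    refine (eLpNorm_le_of_ae_bound (C := ε / 3) ?_).trans (by simp)
    filter_upwards [ae_restrict_mem measurableSet_Ioo] with x hx
    have := hp x (Ioo_subset_Icc_self hx)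
    rw [abs_sub_comm] at this
    exact this.le
  rw [← ENNReal.ofReal_lt_ofReal_iff hε, ← edist_dist, Lp.edist_def]
  calc eLpNorm (⇑f - ⇑(polyToLp p)) 2 (volume.restrict (Ioo (0 : ℝ) 1))
      = eLpNorm ((⇑f - ⇑g) + (⇑g - fun x => p.eval x)) 2 (volume.restrict (Ioo (0 : ℝ) 1)) := by
        refine eLpNorm_congr_ae ?_
        filter_upwards [coeFn_polyToLp p] with x hx
        simp [hx]
    _ ≤ ENNReal.ofReal (ε / 3) + ENNReal.ofReal (ε / 3) :=
        (eLpNorm_add_le ((Lp.aestronglyMeasurable f).sub hgm.1)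
          (hgm.1.sub p.continuous.aestronglyMeasurable) (by norm_num)).trans (add_le_add hg hgp)
    _ < ENNReal.ofReal ε := by
        rw [← ENNReal.ofReal_add (by positivity) (by positivity),
          ENNReal.ofReal_lt_ofReal_iff hε]
        linarith

/-- The shifted Legendre polynomials as a Hilbert basis of `L²(0, 1)`. -/
noncomputable def legendreBasis :
    HilbertBasis ℕ ℝ (Lp ℝ 2 (volume.restrict (Ioo (0 : ℝ) 1))) :=
  HilbertBasis.mk orthonormal_polyToLp_legPoly <| by
    rw [range_comp' polyToLp legPoly, ← Submodule.map_span, span_range_legPoly, Submodule.map_top]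
    exact fun f _ => denseRange_polyToLp f

/-- Parseval's identity for the shifted Legendre polynomials. -/
theorem hasSum_sq_integral_mul_Leg {f : ℝ → ℝ}
    (hf : MemLp f 2 (volume.restrict (Ioo (0 : ℝ) 1))) :
    HasSum (fun j => (∫ u in Ioo (0 : ℝ) 1, f u * Leg j u) ^ 2)
      (∫ u in Ioo (0 : ℝ) 1, f u ^ 2) := by
  have hinner (j : ℕ) : inner ℝ hf.toLp (legendreBasis j)
      = ∫ u in Ioo (0 : ℝ) 1, f u * Leg j u := by
    rw [legendreBasis, HilbertBasis.coe_mk, L2.inner_def]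
    refine integral_congr_ae ?_
    filter_upwards [coeFn_polyToLp (legPoly j), hf.coeFn_toLp] with x hj hx
    simp [hj, hx, legPoly_eval, mul_comm]
  have hself : inner ℝ hf.toLp hf.toLp = ∫ u in Ioo (0 : ℝ) 1, f u ^ 2 := by
    rw [L2.inner_def]
    refine integral_congr_ae ?_
    filter_upwards [hf.coeFn_toLp] with x hx
    simp [hx, sq]
  have h := legendreBasis.hasSum_inner_mul_inner hf.toLp hf.toLp
  rw [hself] at h
  refine h.congr_fun fun j => ?_
  rw [real_inner_comm hf.toLp, hinner, sq]

end Basis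

section Quantile

open ProbabilityTheory Filter Topology

/-- The quantile function of a cumulative distribution function. -/
noncomputable def quantile (F : ℝ → ℝ) (u : ℝ) : ℝ := sInf {x | u ≤ F x}

variable {μ : Measure ℝ} {u : ℝ}

theorem quantile_cdf_le_iff (hF : Continuous (cdf μ)) (hu : u ∈ Ioo (0 : ℝ) 1) (x : ℝ) :
    quantile (cdf μ) u ≤ x ↔ u ≤ cdf μ x := by
  obtain ⟨a, ha⟩ := ((tendsto_cdf_atBot μ).eventually (gt_mem_nhds hu.1)).exists
  obtain ⟨b, hb⟩ := ((tendsto_cdf_atTop μ).eventually (lt_mem_nhds hu.2)).exists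
  have hbdd : BddBelow {x | u ≤ cdf μ x} := ⟨a, fun y hy => by
    by_contra! h
    exact (hy.trans (monotone_cdf μ h.le)).not_gt ha⟩
  have hmem : u ≤ cdf μ (quantile (cdf μ) u) :=
    (isClosed_le continuous_const hF).csInf_mem ⟨b, hb.le⟩ hbdd
  exact ⟨fun h => hmem.trans (monotone_cdf μ h), fun h => csInf_le hbdd h⟩

theorem cdf_quantile (hF : Continuous (cdf μ)) (hu : u ∈ Ioo (0 : ℝ) 1) :
    cdf μ (quantile (cdf μ) u) = u := by
  refine le_antisymm ?_ ((quantile_cdf_le_iff hF hu _).1 le_rfl)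
  refine le_of_tendsto (hF.continuousWithinAt (s := Iio (quantile (cdf μ) u))) ?_
  filter_upwards [self_mem_nhdsWithin] with x hx
  by_contra! h
  exact absurd ((quantile_cdf_le_iff hF hu x).2 h.le) (not_le.2 hx)

theorem aemeasurable_quantile_cdf (hF : Continuous (cdf μ)) :
    AEMeasurable (quantile (cdf μ)) (volume.restrict (Ioo (0 : ℝ) 1)) := by
  refine aemeasurable_restrict_of_monotoneOn measurableSet_Ioo fun u hu v hv huv => ?_
  rw [quantile_cdf_le_iff hF hu, cdf_quantile hF hv]
  exact huv

/-- The quantile function pushes the uniform distribution on `(0, 1)` to the original one. -/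
theorem map_quantile_cdf [IsProbabilityMeasure μ] (hF : Continuous (cdf μ)) :
    (volume.restrict (Ioo (0 : ℝ) 1)).map (quantile (cdf μ)) = μ := by
  refine Measure.ext_of_Iic _ _ fun x => ?_
  rw [Measure.map_apply_of_aemeasurable (aemeasurable_quantile_cdf hF) measurableSet_Iic,
    Measure.restrict_apply' measurableSet_Ioo, ← ofReal_cdf]
  have hset : quantile (cdf μ) ⁻¹' Iic x ∩ Ioo 0 1 = Iic (cdf μ x) ∩ Ioo 0 1 := by
    ext u
    exact and_congr_left fun hu => quantile_cdf_le_iff hF hu x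
  rw [hset, ← Measure.restrict_apply' measurableSet_Ioo, Measure.restrict_congr_set Ioo_ae_eq_Ioc,
    Measure.restrict_apply' measurableSet_Ioc, inter_comm, Ioc_inter_Iic,
    min_eq_right (cdf_le_one μ x), Real.volume_Ioc, sub_zero]

end Quantile

theorem distFun_eq_cdf {Ω : Type*} [MeasurableSpace Ω] (P : Measure Ω) [IsProbabilityMeasure P]
    {X : Ω → ℝ} (hX : Measurable X) : distFun P X = ProbabilityTheory.cdf (P.map X) := by
  have := Measure.isProbabilityMeasure_map (μ := P) hX.aemeasurable
  ext x
  rw [ProbabilityTheory.cdf_eq_real, measureReal_def, Measure.map_apply hX measurableSet_Iic,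
    distFun]

/-- (LP representation of variance.) For a square integrable `X`
with continuous distribution function, `Var[X] = ∑_{j≥1} |LP(j;X)|²` where
`LP(j;X) = E[X · Leg_j(F(X;X))]`. -/
theorem variance_LP_representation {Ω : Type*} [MeasurableSpace Ω]
    (P : Measure Ω) [IsProbabilityMeasure P] (X : Ω → ℝ) (hX : Measurable X)
    (hF : Continuous (distFun P X)) (hX2 : MemLp X 2 P) :
    ProbabilityTheory.variance X P
      = ∑' j : ℕ, |∫ ω, X ω * Leg (j + 1) (distFun P X (X ω)) ∂P| ^ 2 := by
  have := Measure.isProbabilityMeasure_map (μ := P) hX.aemeasurable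
  rw [distFun_eq_cdf P hX] at hF ⊢
  set F := ProbabilityTheory.cdf (P.map X)
  have hQ : AEMeasurable (quantile F) (volume.restrict (Ioo (0 : ℝ) 1)) :=
    aemeasurable_quantile_cdf hF
  have hmap : (volume.restrict (Ioo (0 : ℝ) 1)).map (quantile F) = P.map X := map_quantile_cdf hF
  have htransfer (h : ℝ → ℝ) (hh : Continuous h) :
      ∫ ω, h (X ω) ∂P = ∫ u in Ioo (0 : ℝ) 1, h (quantile F u) := by
    rw [← integral_map hX.aemeasurable hh.aestronglyMeasurable, ← hmap,
      integral_map hQ hh.aestronglyMeasurable]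
  have hQ2 : MemLp (quantile F) 2 (volume.restrict (Ioo (0 : ℝ) 1)) := by
    have h : MemLp id 2 (P.map X) :=
      (memLp_map_measure_iff aestronglyMeasurable_id hX.aemeasurable).2 hX2
    rw [← hmap] at h
    exact (memLp_map_measure_iff aestronglyMeasurable_id hQ).1 h
  have hLeg (j : ℕ) : ∫ ω, X ω * Leg j (F (X ω)) ∂P
      = ∫ u in Ioo (0 : ℝ) 1, quantile F u * Leg j u := by
    have hc : Continuous fun x => x * Leg j (F x) := by
      simp only [← legPoly_eval]
      exact continuous_id.mul ((legPoly j).continuous.comp hF)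
    rw [htransfer _ hc]
    refine setIntegral_congr_fun measurableSet_Ioo fun u hu => ?_
    simp only [F, cdf_quantile hF hu]
  have hsum := hasSum_sq_integral_mul_Leg hQ2
  simp only [← hLeg, ← htransfer (fun x => x ^ 2) (by fun_prop)] at hsum
  rw [← hasSum_nat_add_iff' 1] at hsum
  simp only [sq_abs, hsum.tsum_eq]
  rw [ProbabilityTheory.variance_eq_sub hX2]
  simp [Leg_zero]
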